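/- Fix reals a ≥ 0 and 0 ≤ α ≤ β. Let f : [0,∞) → ℝ be continuous with |f(x)| ≤ M_f·(1+x²) for some constant M_f and such that lim_{x→∞} f(x)/(1+x²) exists and is finite. Then lim_{n→∞} sup_{x≥0} |T_{n,a}^{α,β}(f;x) − f(x)|/(1+x²) = 0. -/

import Mathlib

open MeasureTheory Filter

/-- Rising factorial `(n)_i = n(n+1)⋯(n+i−1)`, with `(n)_0 = 1`. -/
noncomputable def risingFac (n i : ℕ) : ℝ := ∏ j ∈ Finset.range i, ((n : ℝ) + j)

/-- `p_k(n,a) = Σ_{i=0}^{k} C(k,i)·(n)_i·a^{k−i}`. -/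
noncomputable def pCoef (n : ℕ) (a : ℝ) (k : ℕ) : ℝ :=
  ∑ i ∈ Finset.range (k + 1), (Nat.choose k i : ℝ) * risingFac n i * a ^ (k - i)

/-- Generalized Baskakov basis function `W_{n,k}^a(x)`. -/
noncomputable def W (n : ℕ) (a : ℝ) (k : ℕ) (x : ℝ) : ℝ :=
  Real.exp (-(a * x) / (1 + x)) * (pCoef n a k / (Nat.factorial k : ℝ)) * x ^ k /
    (1 + x) ^ (k + n)

/-- Stancu-type operator `L_{n,a}^{α,β}(f;x) = Σ_k W_{n,k}^a(x) f((k+α)/(n+β))`. -/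
noncomputable def Lop (n : ℕ) (a α β : ℝ) (f : ℝ → ℝ) (x : ℝ) : ℝ :=
  ∑' k : ℕ, W n a k x * f (((k : ℝ) + α) / ((n : ℝ) + β))

/-- Generalized Baskakov–Kantorovich–Stancu operator `T_{n,a}^{α,β}(f;x)`. -/
noncomputable def TKS (n : ℕ) (a α β : ℝ) (f : ℝ → ℝ) (x : ℝ) : ℝ :=
  ((n : ℝ) + β) *
    ∑' k : ℕ, W n a k x *
      ∫ t in (((k : ℝ) + α) / ((n : ℝ) + β))..(((k : ℝ) + α + 1) / ((n : ℝ) + β)), f t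

lemma hasSum_conv {g f : ℕ → ℝ} {s t : ℝ} (h : HasSum g t) (hfg : ∀ i, f i = g i) (hst : s = t) :
    HasSum f s := by
  rw [hst, funext hfg]; exact h

lemma risingFac_succ' (n i : ℕ) : risingFac n (i + 1) = n * risingFac (n + 1) i := by
  unfold risingFac
  rw [Finset.prod_range_succ']
  simp only [Nat.cast_zero, add_zero]
  rw [mul_comm]
  congr 1
  apply Finset.prod_congr rfl
  intro j _
  push_cast
  ring

lemma risingFac_nonneg (n i : ℕ) : 0 ≤ risingFac n i :=
  Finset.prod_nonneg fun j _ => by positivity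

lemma risingFac_div (m i : ℕ) :
    risingFac (m + 1) i / (Nat.factorial i : ℝ) = (Nat.choose (i + m) m : ℝ) := by
  have h : risingFac (m + 1) i = ((m + 1).ascFactorial i : ℝ) := by
    induction i with
    | zero => simp [risingFac]
    | succ i ih =>
      unfold risingFac at ih ⊢
      rw [Finset.prod_range_succ, ih, Nat.ascFactorial_succ]
      push_cast
      ring
  rw [h, Nat.ascFactorial_eq_factorial_mul_choose]
  rw [div_eq_iff (by positivity)]
  have : (m + i).choose i = (i + m).choose m := by
    rw [add_comm m i, Nat.choose_symm_add]
  push_cast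
  rw [this]
  ring

/-- Negative binomial part. -/
noncomputable def UU (n : ℕ) (z : ℝ) (i : ℕ) : ℝ := risingFac n i / (Nat.factorial i : ℝ) * z ^ i

/-- Poisson part. -/
noncomputable def VV (c : ℝ) (j : ℕ) : ℝ := c ^ j / (Nat.factorial j : ℝ)

lemma UU_nonneg (n : ℕ) {z : ℝ} (hz : 0 ≤ z) (i : ℕ) : 0 ≤ UU n z i := by
  have := risingFac_nonneg n i
  unfold UU; positivity

lemma VV_nonneg {c : ℝ} (hc : 0 ≤ c) (i : ℕ) : 0 ≤ VV c i := by
  unfold VV; positivity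

lemma UU_sum0 (n : ℕ) (hn : 1 ≤ n) (x : ℝ) (hx : 0 ≤ x) :
    HasSum (UU n (x / (1 + x))) ((1 + x) ^ n) := by
  obtain ⟨m, rfl⟩ : ∃ m, n = m + 1 := ⟨n - 1, by omega⟩
  have hz : ‖x / (1 + x)‖ < 1 := by
    rw [Real.norm_eq_abs, abs_of_nonneg (by positivity), div_lt_one (by positivity)]
    linarith
  have h := hasSum_choose_mul_geometric_of_norm_lt_one m hz
  have e : (1 : ℝ) / (1 - x / (1 + x)) ^ (m + 1) = (1 + x) ^ (m + 1) := by
    have : 1 - x / (1 + x) = (1 + x)⁻¹ := by field_simp; ring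
    rw [this, inv_pow]; simp
  rw [e] at h
  refine h.congr_fun ?_ |> fun h => h
  intro i
  simp [UU, risingFac_div]

lemma UU_succ (n : ℕ) (z : ℝ) (i : ℕ) :
    ((i + 1 : ℕ) : ℝ) * UU n z (i + 1) = n * z * UU (n + 1) z i := by
  unfold UU
  rw [risingFac_succ', Nat.factorial_succ, pow_succ]
  push_cast
  field_simp

lemma VV_succ (c : ℝ) (i : ℕ) :
    ((i + 1 : ℕ) : ℝ) * VV c (i + 1) = c * VV c i := by
  unfold VV
  rw [Nat.factorial_succ, pow_succ]
  push_cast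
  field_simp

lemma hasSum_of_shift {g : ℕ → ℝ} {s : ℝ} (h0 : g 0 = 0) (h : HasSum (fun i => g (i + 1)) s) :
    HasSum g s := by
  rw [← hasSum_nat_add_iff' 1]
  simpa [h0] using h

lemma UU_sum1 (n : ℕ) (hn : 1 ≤ n) (x : ℝ) (hx : 0 ≤ x) :
    HasSum (fun i : ℕ => (i : ℝ) * UU n (x / (1 + x)) i) (n * x * (1 + x) ^ n) := by
  apply hasSum_of_shift (by simp)
  simp only [UU_succ]
  have h := (UU_sum0 (n + 1) (by omega) x hx).mul_left (n * (x / (1 + x)))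
  refine hasSum_conv h (fun i => rfl) ?_
  have : 1 + x ≠ 0 := by positivity
  field_simp
  ring

lemma UU_sum2 (n : ℕ) (hn : 1 ≤ n) (x : ℝ) (hx : 0 ≤ x) :
    HasSum (fun i : ℕ => (i : ℝ) * (i - 1) * UU n (x / (1 + x)) i)
      (n * (n + 1) * x ^ 2 * (1 + x) ^ n) := by
  apply hasSum_of_shift (by simp)
  have h := (UU_sum1 (n + 1) (by omega) x hx).mul_left (n * (x / (1 + x)))
  refine hasSum_conv h ?_ ?_
  · intro i; beta_reduce
    have := UU_succ n (x / (1 + x)) i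
    push_cast at this ⊢
    linear_combination (i : ℝ) * this
  · have : 1 + x ≠ 0 := by positivity
    push_cast
    field_simp
    ring

lemma UU_sumc (n : ℕ) (hn : 1 ≤ n) (x : ℝ) (hx : 0 ≤ x) :
    HasSum (fun i : ℕ => ((i : ℝ) - n * x) ^ 2 * UU n (x / (1 + x)) i)
      (n * x * (1 + x) * (1 + x) ^ n) := by
  have h := ((UU_sum2 n hn x hx).add ((UU_sum1 n hn x hx).mul_left (1 - 2 * (n * x)))).add
    ((UU_sum0 n hn x hx).mul_left ((n * x) ^ 2))
  refine hasSum_conv h ?_ ?_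
  · intro i; ring
  · ring

lemma UU_sumd (n : ℕ) (hn : 1 ≤ n) (x : ℝ) (hx : 0 ≤ x) :
    HasSum (fun i : ℕ => ((i : ℝ) - n * x) * UU n (x / (1 + x)) i) 0 := by
  have h := (UU_sum1 n hn x hx).add ((UU_sum0 n hn x hx).mul_left (-(n * x)))
  refine hasSum_conv h ?_ ?_
  · intro i; ring
  · ring

lemma VV_sum0 (c : ℝ) : HasSum (VV c) (Real.exp c) := by
  have := NormedSpace.expSeries_div_hasSum_exp (𝔸 := ℝ) c
  rw [← Real.exp_eq_exp_ℝ] at this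
  exact this

lemma VV_sum1 (c : ℝ) : HasSum (fun i : ℕ => (i : ℝ) * VV c i) (c * Real.exp c) := by
  apply hasSum_of_shift (by simp)
  simp only [VV_succ]
  exact (VV_sum0 c).mul_left c

lemma VV_sum2 (c : ℝ) : HasSum (fun i : ℕ => (i : ℝ) ^ 2 * VV c i) ((c ^ 2 + c) * Real.exp c) := by
  apply hasSum_of_shift (by simp)
  have h := ((VV_sum1 c).add (VV_sum0 c)).mul_left c
  refine hasSum_conv h ?_ ?_
  · intro i; beta_reduce
    have := VV_succ c i
    push_cast at this ⊢
    linear_combination (i + 1 : ℝ) * this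
  · ring

lemma hasSum_prod_mul {u v : ℕ → ℝ} {s t : ℝ} (hu : HasSum u s) (hv : HasSum v t) :
    HasSum (fun p : ℕ × ℕ => u p.1 * v p.2) (s * t) :=
  hu.mul hv (summable_mul_of_summable_norm hu.summable.norm hv.summable.norm)

lemma hasSum_antidiag {F : ℕ × ℕ → ℝ} {s : ℝ} (h : HasSum F s) :
    HasSum (fun k => ∑ p ∈ Finset.HasAntidiagonal.antidiagonal k, F p) s := by
  have h1 := (Finset.HasAntidiagonal.sigmaAntidiagonalEquivProd (A := ℕ)).hasSum_iff.2 h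
  refine h1.sigma fun k => ?_
  have := Finset.hasSum (Finset.HasAntidiagonal.antidiagonal k) F
  exact this

lemma W_eq (n : ℕ) (a : ℝ) (k : ℕ) (x : ℝ) (hx : 0 ≤ x) :
    W n a k x = (Real.exp (a * (x / (1 + x))) * (1 + x) ^ n)⁻¹ *
      ∑ p ∈ Finset.HasAntidiagonal.antidiagonal k, UU n (x / (1 + x)) p.1 * VV (a * (x / (1 + x))) p.2 := by
  have hx1 : (1 + x) ≠ 0 := by positivity
  rw [Finset.Nat.sum_antidiagonal_eq_sum_range_succ
    (fun i j => UU n (x / (1 + x)) i * VV (a * (x / (1 + x))) j)]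
  have e : ∀ i ∈ Finset.range (k + 1), UU n (x / (1 + x)) i * VV (a * (x / (1 + x))) (k - i)
      = (x / (1 + x)) ^ k / (Nat.factorial k : ℝ) *
        ((Nat.choose k i : ℝ) * risingFac n i * a ^ (k - i)) := by
    intro i hi
    have hik : i ≤ k := by simpa [Nat.lt_succ_iff] using hi
    rw [Nat.cast_choose ℝ hik]
    unfold UU VV
    rw [mul_pow]
    have : (x / (1 + x)) ^ k = (x / (1 + x)) ^ i * (x / (1 + x)) ^ (k - i) := by
      rw [← pow_add]; congr 1; omega
    rw [this]
    have := Nat.cast_ne_zero (R := ℝ).2 (Nat.factorial_ne_zero k)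
    have := Nat.cast_ne_zero (R := ℝ).2 (Nat.factorial_ne_zero i)
    have := Nat.cast_ne_zero (R := ℝ).2 (Nat.factorial_ne_zero (k - i))
    generalize (x / (1 + x)) = z
    field_simp
  rw [Finset.sum_congr rfl e, ← Finset.mul_sum]
  unfold W pCoef
  have e2 : -(a * x) / (1 + x) = -(a * (x / (1 + x))) := by ring
  rw [e2, Real.exp_neg, mul_inv, div_pow, pow_add]
  field_simp

lemma W_nonneg (n : ℕ) (a : ℝ) (ha : 0 ≤ a) (k : ℕ) (x : ℝ) (hx : 0 ≤ x) : 0 ≤ W n a k x := by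
  have : 0 ≤ pCoef n a k := Finset.sum_nonneg fun i _ => by
    have := risingFac_nonneg n i
    positivity
  unfold W
  positivity

lemma W_sum0 (n : ℕ) (hn : 1 ≤ n) (a : ℝ) (x : ℝ) (hx : 0 ≤ x) :
    HasSum (fun k => W n a k x) 1 := by
  have h := (hasSum_antidiag (hasSum_prod_mul (UU_sum0 n hn x hx)
    (VV_sum0 (a * (x / (1 + x)))))).mul_left (Real.exp (a * (x / (1 + x))) * (1 + x) ^ n)⁻¹
  refine hasSum_conv h ?_ ?_
  · intro k; exact W_eq n a k x hx
  · have hx1 : (1 + x) ≠ 0 := by positivity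
    field_simp

lemma W_sum2 (n : ℕ) (hn : 1 ≤ n) (a : ℝ) (x : ℝ) (hx : 0 ≤ x) :
    HasSum (fun k : ℕ => W n a k x * ((k : ℝ) - n * x) ^ 2)
      (n * x * (1 + x) + ((a * (x / (1 + x))) ^ 2 + a * (x / (1 + x)))) := by
  set c := a * (x / (1 + x)) with hc
  have h1 := hasSum_prod_mul (UU_sumc n hn x hx) (VV_sum0 c)
  have h2 := (hasSum_prod_mul (UU_sumd n hn x hx) (VV_sum1 c)).mul_left 2
  have h3 := hasSum_prod_mul (UU_sum0 n hn x hx) (VV_sum2 c)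
  have h := (hasSum_antidiag ((h1.add h2).add h3)).mul_left (Real.exp c * (1 + x) ^ n)⁻¹
  refine hasSum_conv h ?_ ?_
  · intro k; beta_reduce
    rw [W_eq n a k x hx, ← hc, mul_assoc, Finset.sum_mul]
    congr 1
    apply Finset.sum_congr rfl
    intro p hp
    have : (k : ℝ) = p.1 + p.2 := by
      rw [← Finset.HasAntidiagonal.mem_antidiagonal.1 hp]; push_cast; rfl
    rw [this]
    ring
  · have hx1 : (1 + x) ≠ 0 := by positivity
    field_simp
    ring

lemma key_ineq (f : ℝ → ℝ) (hf : ContinuousOn f (Set.Ici 0))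
    (l : ℝ) (hlim : Tendsto (fun x : ℝ => f x / (1 + x ^ 2)) atTop (nhds l))
    (ε : ℝ) (hε : 0 < ε) :
    ∃ C : ℝ, 0 ≤ C ∧ ∀ t x : ℝ, 0 ≤ t → 0 ≤ x →
      |f t - f x| ≤ ε * (1 + x ^ 2) + C * (t - x) ^ 2 := by
  -- it suffices to treat the decaying part and the quadratic part
  obtain ⟨g, hg⟩ : ∃ g : ℝ → ℝ, g = fun x => f x - l * (1 + x ^ 2) := ⟨_, rfl⟩
  have hgc : ContinuousOn g (Set.Ici 0) := by
    rw [hg]; exact hf.sub (by fun_prop)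
  obtain ⟨η, hη0, hη⟩ : ∃ η : ℝ, 0 < η ∧ 6 * η ≤ ε := ⟨ε / 6, by positivity, by linarith⟩
  obtain ⟨R, hR0, hR⟩ : ∃ R : ℝ, 0 ≤ R ∧ ∀ x, R ≤ x → |g x| ≤ η * (1 + x ^ 2) := by
    have h1 := (Metric.tendsto_nhds.1 hlim) η hη0
    obtain ⟨R, hR⟩ := eventually_atTop.1 h1
    refine ⟨max R 0, le_max_right _ _, fun x hx => ?_⟩
    have h2 := hR x (le_trans (le_max_left _ _) hx)
    rw [Real.dist_eq] at h2
    have hp : 0 < 1 + x ^ 2 := by positivity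
    have : g x = (f x / (1 + x ^ 2) - l) * (1 + x ^ 2) := by
      rw [hg]; field_simp
    rw [this, abs_mul, abs_of_pos hp]
    gcongr
  have hK : IsCompact (Set.Icc 0 (R + 1)) := isCompact_Icc
  have hgK : ContinuousOn g (Set.Icc 0 (R + 1)) := hgc.mono Set.Icc_subset_Ici_self
  obtain ⟨B, hB⟩ := hK.exists_bound_of_continuousOn hgK
  have hB0 : 0 ≤ B := le_trans (norm_nonneg _) (hB 0 ⟨le_rfl, by linarith⟩)
  obtain ⟨δ, hδ0, hδ⟩ := Metric.uniformContinuousOn_iff.1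
    (hK.uniformContinuousOn_of_continuous hgK) η hη0
  have hgmain : ∀ t x : ℝ, 0 ≤ t → 0 ≤ x →
      |g t - g x| ≤ η * (1 + x ^ 2) + η * (1 + t ^ 2) + (2 * B / δ ^ 2 + B) * (t - x) ^ 2 := by
    intro t x ht hx
    have hC : 0 ≤ 2 * B / δ ^ 2 := by positivity
    have hA : 0 ≤ 2 * B / δ ^ 2 * (t - x) ^ 2 := by positivity
    have hD : 0 ≤ B * (t - x) ^ 2 := by positivity
    have hE : 0 ≤ η * x ^ 2 := by positivity
    have hF : 0 ≤ η * t ^ 2 := by positivity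
    have htri : |g t - g x| ≤ |g t| + |g x| := abs_sub _ _
    by_cases h1 : t ≤ R + 1 ∧ x ≤ R + 1
    · by_cases h2 : dist t x < δ
      · have := hδ t ⟨ht, h1.1⟩ x ⟨hx, h1.2⟩ h2
        rw [Real.dist_eq] at this
        nlinarith
      · have h3 := hB t ⟨ht, h1.1⟩
        have h4 := hB x ⟨hx, h1.2⟩
        rw [Real.norm_eq_abs] at h3 h4
        rw [Real.dist_eq, not_lt] at h2
        have h5 : δ ^ 2 ≤ (t - x) ^ 2 := by
          rw [← sq_abs (t - x)]; gcongr
        have h6 : 2 * B ≤ 2 * B / δ ^ 2 * (t - x) ^ 2 := by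
          calc 2 * B = 2 * B / δ ^ 2 * δ ^ 2 := by field_simp
            _ ≤ _ := by gcongr
        nlinarith
    · by_cases h2 : R ≤ t
      · have h3 := hR t h2
        by_cases h4 : R ≤ x
        · have h5 := hR x h4
          nlinarith
        · push Not at h4
          have h5 := hB x ⟨hx, by linarith⟩
          rw [Real.norm_eq_abs] at h5
          have h6 : R + 1 < t := by
            by_contra h; push Not at h; exact h1 ⟨h, by linarith⟩
          have h7 : 1 ≤ (t - x) ^ 2 := by nlinarith
          have h8 : B ≤ B * (t - x) ^ 2 := by nlinarith
          nlinarith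
      · push Not at h2
        have h5 := hB t ⟨ht, by linarith⟩
        rw [Real.norm_eq_abs] at h5
        have h6 : R + 1 < x := by
          by_contra h; push Not at h; exact h1 ⟨by linarith, h⟩
        have h3 := hR x (by linarith)
        have h7 : 1 ≤ (t - x) ^ 2 := by nlinarith
        have h8 : B ≤ B * (t - x) ^ 2 := by nlinarith
        nlinarith
  have hquad : ∀ t x : ℝ, |l * (t ^ 2 - x ^ 2)| ≤ η * x ^ 2 + (|l| + l ^ 2 / η) * (t - x) ^ 2 := by
    intro t x
    have e : l * (t ^ 2 - x ^ 2) = l * (t - x) ^ 2 + 2 * (l * (t - x)) * x := by ring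
    have h1 : |l * (t - x) ^ 2| = |l| * (t - x) ^ 2 := by
      rw [abs_mul, abs_of_nonneg (sq_nonneg (t - x))]
    have h2 : |2 * (l * (t - x)) * x| ≤ η * x ^ 2 + l ^ 2 / η * (t - x) ^ 2 := by
      have e1 : l ^ 2 / η * (t - x) ^ 2 = η * (l * (t - x) / η) ^ 2 := by field_simp
      have e2 : 2 * (l * (t - x)) * x = η * (2 * (l * (t - x) / η) * x) := by field_simp
      rw [e1, e2, abs_mul, abs_of_pos hη0, ← mul_add]
      gcongr
      rw [abs_le]
      constructor <;> nlinarith [sq_nonneg (l * (t - x) / η + x), sq_nonneg (l * (t - x) / η - x)]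
    rw [e]
    have := abs_add_le (l * (t - x) ^ 2) (2 * (l * (t - x)) * x)
    nlinarith
  refine ⟨(2 * B / δ ^ 2 + B) + (|l| + l ^ 2 / η) + 2 * η, by positivity, fun t x ht hx => ?_⟩
  have e : f t - f x = (g t - g x) + l * (t ^ 2 - x ^ 2) := by rw [hg]; ring
  rw [e]
  have h0 := abs_add_le (g t - g x) (l * (t ^ 2 - x ^ 2))
  have h1 := hgmain t x ht hx
  have h2 := hquad t x
  have h3 : t ^ 2 ≤ 2 * x ^ 2 + 2 * (t - x) ^ 2 := by nlinarith [sq_nonneg (t - 2 * x)]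
  have h4 : η * t ^ 2 ≤ η * (2 * x ^ 2 + 2 * (t - x) ^ 2) := by gcongr
  have h5 : 6 * η * (1 + x ^ 2) ≤ ε * (1 + x ^ 2) := by gcongr
  have h6 : 0 ≤ η * x ^ 2 := by positivity
  nlinarith

lemma TKS_bound (a : ℝ) (ha : 0 ≤ a) (α β : ℝ) (hα : 0 ≤ α) (hαβ : α ≤ β)
    (f : ℝ → ℝ) (hf : ContinuousOn f (Set.Ici 0)) (ε C : ℝ) (hC : 0 ≤ C)
    (hkey : ∀ t x : ℝ, 0 ≤ t → 0 ≤ x →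
      |f t - f x| ≤ ε * (1 + x ^ 2) + C * (t - x) ^ 2) (n : ℕ) (hn : 1 ≤ n)
    (x : ℝ) (hx : 0 ≤ x) :
    |TKS n a α β f x - f x| ≤
      (ε + C * (4 + 2 * (a + a ^ 2) + 4 * (α + 1) ^ 2 + 4 * β ^ 2) / n) * (1 + x ^ 2) := by
  have hn' : (1 : ℝ) ≤ n := by exact_mod_cast hn
  obtain ⟨q, hq⟩ : ∃ q : ℝ, q = n + β := ⟨_, rfl⟩
  have hnq : (n : ℝ) ≤ q := by rw [hq]; linarith
  have hq0 : 0 < q := by linarith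
  obtain ⟨I, hI⟩ : ∃ I : ℕ → ℝ, I = fun k : ℕ =>
    ∫ t in (((k : ℝ) + α) / q)..(((k : ℝ) + α + 1) / q), f t := ⟨_, rfl⟩
  have hT : TKS n a α β f x = q * ∑' k : ℕ, W n a k x * I k := by
    unfold TKS; rw [hI, hq]
  have hterm : ∀ k : ℕ, |q * I k - f x| ≤ ε * (1 + x ^ 2) +
      C * ((2 * ((k : ℝ) - n * x) ^ 2 + 2 * (α + 1 + β * x) ^ 2) / q ^ 2) := by
    intro k
    have hab : ((k : ℝ) + α) / q ≤ ((k : ℝ) + α + 1) / q := by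
      apply div_le_div_of_nonneg_right _ hq0.le; linarith
    have h0 : 0 ≤ ((k : ℝ) + α) / q := by positivity
    have hint : IntervalIntegrable f volume (((k : ℝ) + α) / q) (((k : ℝ) + α + 1) / q) := by
      apply ContinuousOn.intervalIntegrable
      apply hf.mono
      rw [Set.uIcc_of_le hab]
      intro t ht
      exact h0.trans ht.1
    have hlen : ((k : ℝ) + α + 1) / q - ((k : ℝ) + α) / q = 1 / q := by ring
    have e : q * I k - f x =
        q * ∫ t in (((k : ℝ) + α) / q)..(((k : ℝ) + α + 1) / q), (f t - f x) := by
      rw [intervalIntegral.integral_sub hint (by simp), intervalIntegral.integral_const, hlen, hI]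
      simp only [smul_eq_mul]
      field_simp
    have hb := intervalIntegral.norm_integral_le_of_norm_le_const
      (a := ((k : ℝ) + α) / q) (b := ((k : ℝ) + α + 1) / q) (f := fun t => f t - f x)
      (C := ε * (1 + x ^ 2) +
        C * ((2 * ((k : ℝ) - n * x) ^ 2 + 2 * (α + 1 + β * x) ^ 2) / q ^ 2)) (by
        intro t ht
        rw [Set.uIoc_of_le hab] at ht
        have ht0 : 0 ≤ t := h0.trans ht.1.le
        rw [Real.norm_eq_abs]
        refine (hkey t x ht0 hx).trans ?_
        gcongr
        rw [le_div_iff₀ (by positivity), ← mul_pow]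
        have h1 : (k : ℝ) + α ≤ t * q := by
          have := ht.1.le; rwa [div_le_iff₀ hq0] at this
        have h2 : t * q ≤ (k : ℝ) + α + 1 := by
          have := ht.2; rwa [le_div_iff₀ hq0] at this
        have e : (t - x) * q = ((k : ℝ) - n * x) + (t * q - k - β * x) := by rw [hq]; ring
        have hβ : 0 ≤ β * x := mul_nonneg (hα.trans hαβ) hx
        have h3 : (t * q - k - β * x) ^ 2 ≤ (α + 1 + β * x) ^ 2 := by
          apply sq_le_sq'
          · linarith
          · linarith
        rw [e]
        nlinarith [sq_nonneg (((k : ℝ) - n * x) - (t * q - k - β * x))])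
    rw [hlen, Real.norm_eq_abs] at hb
    rw [e, abs_mul, abs_of_pos hq0]
    calc _ ≤ _ := mul_le_mul_of_nonneg_left hb hq0.le
      _ = _ := by rw [abs_of_pos (by positivity : 0 < 1 / q)]; field_simp
  have hS0 := W_sum0 n hn a x hx
  have hS2 := W_sum2 n hn a x hx
  have hbd := (hS0.mul_left (ε * (1 + x ^ 2) + C * (2 * (α + 1 + β * x) ^ 2 / q ^ 2))).add
    (hS2.mul_left (C * 2 / q ^ 2))
  have hle : ∀ k : ℕ, ‖W n a k x * (q * I k - f x)‖ ≤
      (ε * (1 + x ^ 2) + C * (2 * (α + 1 + β * x) ^ 2 / q ^ 2)) * W n a k x +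
        C * 2 / q ^ 2 * (W n a k x * ((k : ℝ) - n * x) ^ 2) := by
    intro k
    rw [norm_mul, Real.norm_eq_abs, Real.norm_eq_abs, abs_of_nonneg (W_nonneg n a ha k x hx)]
    calc _ ≤ _ := mul_le_mul_of_nonneg_left (hterm k) (W_nonneg n a ha k x hx)
      _ = _ := by ring
  have hsum : Summable fun k : ℕ => W n a k x * (q * I k - f x) :=
    Summable.of_norm_bounded hbd.summable hle
  have hTeq : TKS n a α β f x - f x = ∑' k : ℕ, W n a k x * (q * I k - f x) := by
    have h1 := hsum.hasSum.add (hS0.mul_left (f x))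
    have h2 : HasSum (fun k => q * (W n a k x * I k))
        (∑' k : ℕ, W n a k x * (q * I k - f x) + f x * 1) := by
      convert h1 using 1
      ext k; ring
    rw [hT, ← tsum_mul_left, h2.tsum_eq]
    ring
  rw [hTeq, ← Real.norm_eq_abs]
  refine (tsum_of_norm_bounded hbd hle).trans ?_
  have hz0 : 0 ≤ x / (1 + x) := by positivity
  have hz1 : x / (1 + x) ≤ 1 := by rw [div_le_one (by positivity)]; linarith
  have hc1 : a * (x / (1 + x)) ≤ a := mul_le_of_le_one_right ha hz1
  have hc0 : 0 ≤ a * (x / (1 + x)) := by positivity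
  have hc2 : (a * (x / (1 + x))) ^ 2 ≤ a ^ 2 := by gcongr
  have hq2 : (n : ℝ) ^ 2 ≤ q ^ 2 := by gcongr
  have hxx : x * (1 + x) ≤ 2 * (1 + x ^ 2) := by nlinarith [sq_nonneg (x - 1)]
  have hv : (n : ℝ) * x * (1 + x) + ((a * (x / (1 + x))) ^ 2 + a * (x / (1 + x))) ≤
      n * ((2 + (a + a ^ 2)) * (1 + x ^ 2)) := by
    have h1 : (n : ℝ) * (x * (1 + x)) ≤ n * (2 * (1 + x ^ 2)) := by gcongr
    have h2 : a + a ^ 2 ≤ n * ((a + a ^ 2) * (1 + x ^ 2)) := by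
      have : (1 : ℝ) ≤ n * (1 + x ^ 2) := by nlinarith [sq_nonneg x]
      nlinarith [sq_nonneg a, mul_le_mul_of_nonneg_left this (by positivity : 0 ≤ a + a ^ 2)]
    nlinarith
  have hw : (α + 1 + β * x) ^ 2 ≤ n * ((2 * (α + 1) ^ 2 + 2 * β ^ 2) * (1 + x ^ 2)) := by
    have h1 : (α + 1 + β * x) ^ 2 ≤ (2 * (α + 1) ^ 2 + 2 * β ^ 2) * (1 + x ^ 2) := by
      nlinarith [sq_nonneg (α + 1 - β * x), mul_nonneg (sq_nonneg (α + 1)) (sq_nonneg x),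
        sq_nonneg β]
    have h2 : 0 ≤ (2 * (α + 1) ^ 2 + 2 * β ^ 2) * (1 + x ^ 2) := by positivity
    nlinarith
  have hn0 : (0 : ℝ) < n := by linarith
  calc _ = ε * (1 + x ^ 2) + C * 2 * ((α + 1 + β * x) ^ 2 + ((n : ℝ) * x * (1 + x) +
        ((a * (x / (1 + x))) ^ 2 + a * (x / (1 + x))))) / q ^ 2 := by ring
    _ ≤ ε * (1 + x ^ 2) + C * 2 * (n * ((2 * (α + 1) ^ 2 + 2 * β ^ 2) * (1 + x ^ 2)) +
        n * ((2 + (a + a ^ 2)) * (1 + x ^ 2))) / (n : ℝ) ^ 2 := by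
      gcongr
    _ = _ := by field_simp; ring

theorem Top_weighted_convergence (a : ℝ) (ha : 0 ≤ a) (α β : ℝ) (hα : 0 ≤ α) (hαβ : α ≤ β)
    (f : ℝ → ℝ) (hf : ContinuousOn f (Set.Ici 0))
    (hgrowth : ∃ Mf : ℝ, ∀ x : ℝ, 0 ≤ x → |f x| ≤ Mf * (1 + x ^ 2))
    (hlim : ∃ l : ℝ, Tendsto (fun x : ℝ => f x / (1 + x ^ 2)) atTop (nhds l)) :
    Tendsto (fun n : ℕ =>
        ⨆ x : {x : ℝ // 0 ≤ x}, |TKS n a α β f x.val - f x.val| / (1 + x.val ^ 2))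
      atTop (nhds 0) := by
  obtain ⟨l, hl⟩ := hlim
  rw [Metric.tendsto_nhds]
  intro ε hε
  obtain ⟨C, hC, hkey⟩ := key_ineq f hf l hl (ε / 2) (by positivity)
  have hlim2 : Tendsto (fun n : ℕ => ε / 2 +
      C * (4 + 2 * (a + a ^ 2) + 4 * (α + 1) ^ 2 + 4 * β ^ 2) / (n : ℝ)) atTop
      (nhds (ε / 2 + 0)) :=
    tendsto_const_nhds.add (tendsto_const_div_atTop_nhds_zero_nat _)
  have hev := hlim2.eventually (gt_mem_nhds (by linarith : ε / 2 + 0 < ε))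
  filter_upwards [hev, eventually_ge_atTop 1] with n h1 hn
  rw [Real.dist_eq, sub_zero, abs_of_nonneg (Real.iSup_nonneg fun x => by positivity)]
  refine lt_of_le_of_lt (Real.iSup_le (fun x => ?_) ?_) h1
  · rw [div_le_iff₀ (by positivity)]
    exact TKS_bound a ha α β hα hαβ f hf (ε / 2) C hC hkey n hn x.1 x.2
  · positivity
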